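/- Let Z be a curve in ℝ^d and let Ẑ = Z[s,t] (for some 0 ≤ s ≤ t ≤ 1) be a subcurve of Z. Then d_F(spine(Ẑ), Ẑ) ≤ 2·d_F(spine(Z), Z). -/

import Mathlib

open Set

noncomputable section

namespace Jaywalk

variable {d : ℕ}

/-- An orientation-preserving reparameterization of `[0,1]`: a continuous, strictly
increasing bijection of `[0,1]` onto itself with `f 0 = 0` and `f 1 = 1`. -/
structure IsReparam (f : ℝ → ℝ) : Prop where
  contOn : ContinuousOn f (Icc 0 1)
  strictMonoOn : StrictMonoOn f (Icc 0 1)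
  mapsTo : MapsTo f (Icc 0 1) (Icc 0 1)
  surjOn : SurjOn f (Icc 0 1) (Icc 0 1)
  map_zero : f 0 = 0
  map_one : f 1 = 1

/-- The width of a reparameterization `f` with respect to curves `X Y : [0,1] → ℝ^d`. -/
def frechetWidth (X Y : ℝ → EuclideanSpace ℝ (Fin d)) (f : ℝ → ℝ) : ℝ :=
  ⨆ t : Icc (0:ℝ) 1, ‖X (f ↑t) - Y ↑t‖

/-- The Fréchet distance between two curves `X Y : [0,1] → ℝ^d`. -/
def frechetDist (X Y : ℝ → EuclideanSpace ℝ (Fin d)) : ℝ :=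
  sInf {w | ∃ f, IsReparam f ∧ w = frechetWidth X Y f}

/-- The segment from `p` to `q`, as a curve `t ↦ (1-t)·p + t·q`. -/
def seg (p q : EuclideanSpace ℝ (Fin d)) : ℝ → EuclideanSpace ℝ (Fin d) :=
  fun t => (1 - t) • p + t • q

/-- The subcurve `Z[s,t]`, affinely reparameterized over `[0,1]`. -/
def subcurve (Z : ℝ → EuclideanSpace ℝ (Fin d)) (s t : ℝ) : ℝ → EuclideanSpace ℝ (Fin d) :=
  fun τ => Z (s + τ * (t - s))

/-- Vertices extended to all of `ℕ` (clamped at `n`). -/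
def vtx {n : ℕ} (v : Fin (n+1) → EuclideanSpace ℝ (Fin d)) (i : ℕ) :
    EuclideanSpace ℝ (Fin d) :=
  v ⟨min i n, Nat.lt_succ_of_le (min_le_right i n)⟩

/-- The uniformly parameterized polygonal curve through the vertices `v 0, …, v n`. -/
def polyCurve {n : ℕ} (v : Fin (n+1) → EuclideanSpace ℝ (Fin d)) :
    ℝ → EuclideanSpace ℝ (Fin d) :=
  fun t =>
    (1 - (t * n - ⌊t * n⌋₊)) • vtx v ⌊t * n⌋₊ + (t * n - ⌊t * n⌋₊) • vtx v (⌊t * n⌋₊ + 1)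

/-- Concatenation of two curves (sharing an endpoint). -/
def concat (A B : ℝ → EuclideanSpace ℝ (Fin d)) : ℝ → EuclideanSpace ℝ (Fin d) :=
  fun t => if t ≤ 1/2 then A (2 * t) else B (2 * t - 1)

/-- Concatenation of a finite list of curves. -/
def concatList : List (ℝ → EuclideanSpace ℝ (Fin d)) → ℝ → EuclideanSpace ℝ (Fin d)
  | [] => fun _ => 0
  | [A] => A
  | A :: B :: rest => concat A (concatList (B :: rest))

/-- Given curves `X Y`, the price of the tunnel from `a` to `b` (points of `[0,1]²`):
the Fréchet distance between the subcurve `X[a.1, b.1]` and the segment from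
`Y a.2` to `Y b.2`. -/
def tunnelPrice (X Y : ℝ → EuclideanSpace ℝ (Fin d)) (a b : ℝ × ℝ) : ℝ :=
  frechetDist (subcurve X a.1 b.1) (seg (Y a.2) (Y b.2))

open Classical in
/-- Indices of marked vertices in the greedy `μ`-simplification of the polygonal curve with
vertices `v 0, …, v n`:  start at vertex `0`; repeatedly jump to the first later vertex at
distance at least `μ` from the current one; finally also mark the last vertex `n`
(the sequence stabilizes at `n`). -/
def simplIdx (v : ℕ → EuclideanSpace ℝ (Fin d)) (μ : ℝ) (n : ℕ) : ℕ → ℕ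
  | 0 => 0
  | k+1 =>
    if h : ∃ j, simplIdx v μ n k < j ∧ j ≤ n ∧ μ ≤ ‖v j - v (simplIdx v μ n k)‖
    then Nat.find h
    else n

/-- The vertices of the `μ`-simplification (with the final vertex repeated). -/
def simplVerts {n : ℕ} (v : Fin (n+1) → EuclideanSpace ℝ (Fin d)) (μ : ℝ) :
    Fin (n+1) → EuclideanSpace ℝ (Fin d) :=
  fun k => vtx v (simplIdx (vtx v) μ n k.val)

/-- The `μ`-simplification `simpl(X, μ)` of the polygonal curve with vertices
`v 0, …, v n`: the polygonal curve through the marked vertices, in order. -/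
def simpl {n : ℕ} (v : Fin (n+1) → EuclideanSpace ℝ (Fin d)) (μ : ℝ) :
    ℝ → EuclideanSpace ℝ (Fin d) :=
  polyCurve (simplVerts v μ)

/-- `y` is the parameter of a vertex of a (uniformly parameterized) polygonal curve
with `n` edges. -/
def vertexParam (n : ℕ) (y : ℝ) : Prop := ∃ i : Fin (n+1), y = ((i : ℕ) : ℝ) / n

/-- The shortcut curve of `Y` determined by the list of shortcut parameter pairs,
starting from parameter `a`. -/
def shortcutFrom (Y : ℝ → EuclideanSpace ℝ (Fin d)) :
    List (ℝ × ℝ) → ℝ → ℝ → EuclideanSpace ℝ (Fin d)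
  | [], a => subcurve Y a 1
  | (y₁, y₂) :: rest, a =>
      concat (subcurve Y a y₁) (concat (seg (Y y₁) (Y y₂)) (shortcutFrom Y rest y₂))

/-- The shortcut parameter pairs form a nondecreasing sequence inside `[0,1]` and all
parameters are vertices of the polygonal curve with `n` edges. -/
def ValidShortcuts (n : ℕ) (L : List (ℝ × ℝ)) : Prop :=
  List.Chain' (· ≤ ·) ((0:ℝ) :: (L.flatMap fun p => [p.1, p.2]) ++ [1]) ∧
  ∀ p ∈ L, vertexParam n p.1 ∧ vertexParam n p.2

/-- The directed vertex-restricted `k`-shortcut Fréchet distance between a curve `X` and the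
polygonal curve with vertices `w 0, …, w n`: the infimum of the Fréchet distance between `X`
and any vertex-restricted shortcut curve of `polyCurve w` with at most `k` shortcuts. -/
def shortcutFrechetDist {n : ℕ} (X : ℝ → EuclideanSpace ℝ (Fin d))
    (w : Fin (n+1) → EuclideanSpace ℝ (Fin d)) (k : ℕ) : ℝ :=
  sInf {r | ∃ L : List (ℝ × ℝ), L.length ≤ k ∧ ValidShortcuts n L ∧
    r = frechetDist X (shortcutFrom (polyCurve w) L 0)}

/-- The directed vertex-restricted shortcut Fréchet distance (unbounded number of
shortcuts). -/
def shortcutFrechetDistUnbounded {n : ℕ} (X : ℝ → EuclideanSpace ℝ (Fin d))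
    (w : Fin (n+1) → EuclideanSpace ℝ (Fin d)) : ℝ :=
  sInf {r | ∃ L : List (ℝ × ℝ), ValidShortcuts n L ∧
    r = frechetDist X (shortcutFrom (polyCurve w) L 0)}

theorem frechetWidth_nonneg (X Y : ℝ → EuclideanSpace ℝ (Fin d)) (f : ℝ → ℝ) :
    0 ≤ frechetWidth X Y f :=
  Real.iSup_nonneg fun _ => norm_nonneg _

theorem IsReparam.of_strictMonoOn {f : ℝ → ℝ} (hc : ContinuousOn f (Icc 0 1))
    (hm : StrictMonoOn f (Icc 0 1)) (h0 : f 0 = 0) (h1 : f 1 = 1) : IsReparam f where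
  contOn := hc
  strictMonoOn := hm
  mapsTo := by
    have h := hm.monotoneOn.mapsTo_Icc
    rwa [h0, h1] at h
  surjOn := by
    have h := intermediate_value_Icc zero_le_one hc
    rwa [h0, h1] at h
  map_zero := h0
  map_one := h1

theorem IsReparam.id : IsReparam (fun x => x) :=
  .of_strictMonoOn continuousOn_id (strictMono_id.strictMonoOn _) rfl rfl

theorem frechetDist_le_of_forall_norm_le {X Y : ℝ → EuclideanSpace ℝ (Fin d)} {f : ℝ → ℝ} {c : ℝ}
    (hf : IsReparam f) (h : ∀ x ∈ Icc (0 : ℝ) 1, ‖X (f x) - Y x‖ ≤ c) :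
    frechetDist X Y ≤ c := by
  have hbdd : BddBelow {w | ∃ f, IsReparam f ∧ w = frechetWidth X Y f} := by
    refine ⟨0, ?_⟩
    rintro _ ⟨g, -, rfl⟩
    exact frechetWidth_nonneg X Y g
  have : Nonempty (Icc (0 : ℝ) 1) := ⟨⟨0, by simp⟩⟩
  exact (csInf_le hbdd ⟨f, hf, rfl⟩).trans (ciSup_le fun x => h x x.2)

theorem norm_sub_le_frechetWidth {X Y : ℝ → EuclideanSpace ℝ (Fin d)} {f : ℝ → ℝ}
    (hf : IsReparam f) (hX : ContinuousOn X (Icc 0 1)) (hY : ContinuousOn Y (Icc 0 1))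
    {x : ℝ} (hx : x ∈ Icc (0 : ℝ) 1) : ‖X (f x) - Y x‖ ≤ frechetWidth X Y f := by
  have hc : ContinuousOn (fun x => ‖X (f x) - Y x‖) (Icc 0 1) :=
    ((hX.comp hf.contOn hf.mapsTo).sub hY).norm
  have hbdd : BddAbove (range fun x : Icc (0 : ℝ) 1 => ‖X (f x) - Y x‖) := by
    obtain ⟨c, hc⟩ := isCompact_Icc.bddAbove_image hc
    refine ⟨c, ?_⟩
    rintro _ ⟨y, rfl⟩
    exact hc ⟨y, y.2, rfl⟩
  exact le_ciSup hbdd ⟨x, hx⟩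

theorem continuous_seg (p q : EuclideanSpace ℝ (Fin d)) : Continuous (seg p q) := by
  unfold seg
  fun_prop

/-- Points with the same parameter on two segments are no further apart than the endpoints. -/
theorem norm_seg_sub_seg_le {p q p' q' : EuclideanSpace ℝ (Fin d)} {c x : ℝ}
    (hx : x ∈ Icc (0 : ℝ) 1) (hp : ‖p - p'‖ ≤ c) (hq : ‖q - q'‖ ≤ c) :
    ‖seg p q x - seg p' q' x‖ ≤ c := by
  have h : seg p q x - seg p' q' x = (1 - x) • (p - p') + x • (q - q') := by
    simp only [seg]
    module
  rw [h, ← mem_closedBall_zero_iff]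
  exact convex_closedBall 0 c (mem_closedBall_zero_iff.2 hp) (mem_closedBall_zero_iff.2 hq)
    (sub_nonneg.2 hx.2) hx.1 (by ring)

theorem seg_seg (p q : EuclideanSpace ℝ (Fin d)) (a b x : ℝ) :
    seg (seg p q a) (seg p q b) x = seg p q (a + x * (b - a)) := by
  simp only [seg]
  module

/-- The rescaling of a reparameterization to a subinterval of `[0,1]`. -/
theorem IsReparam.exists_restrict {f : ℝ → ℝ} (hf : IsReparam f) {s t : ℝ}
    (hs : 0 ≤ s) (hst : s ≤ t) (ht : t ≤ 1) :
    ∃ g, IsReparam g ∧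
      ∀ x ∈ Icc (0 : ℝ) 1, f s + g x * (f t - f s) = f (s + x * (t - s)) := by
  obtain rfl | hlt := hst.eq_or_lt
  · exact ⟨_, .id, by simp⟩
  have hpos : 0 < f t - f s :=
    sub_pos.2 (hf.strictMonoOn ⟨hs, hst.trans ht⟩ ⟨hs.trans hst, ht⟩ hlt)
  have hmaps : MapsTo (fun x => s + x * (t - s)) (Icc 0 1) (Icc 0 1) := by
    rintro x ⟨h0, h1⟩
    constructor <;> nlinarith
  refine ⟨fun x => (f (s + x * (t - s)) - f s) / (f t - f s), .of_strictMonoOn ?_ ?_ ?_ ?_, ?_⟩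
  · exact ((hf.contOn.comp (by fun_prop) hmaps).sub continuousOn_const).div_const _
  · intro x hx y hy hxy
    have h := hf.strictMonoOn (hmaps hx) (hmaps hy)
      (by simpa using mul_lt_mul_of_pos_right hxy (sub_pos.2 hlt))
    exact div_lt_div_of_pos_right (by simpa using h) hpos
  · simp
  · simp [hpos.ne']
  · intro x _
    field_simp
    ring

/-- For a curve `Z` and a subcurve `Ẑ = Z[s,t]`, the Fréchet distance
of `Ẑ` to its spine is at most twice the Fréchet distance of `Z` to its spine. -/
theorem frechetDist_spine_subcurve {d : ℕ} (Z : ℝ → EuclideanSpace ℝ (Fin d))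
    (hZ : ContinuousOn Z (Icc 0 1))
    (s t : ℝ) (hs : 0 ≤ s) (hst : s ≤ t) (ht : t ≤ 1) :
    frechetDist (seg (Z s) (Z t)) (subcurve Z s t) ≤
      2 * frechetDist (seg (Z 0) (Z 1)) Z := by
  suffices h : frechetDist (seg (Z s) (Z t)) (subcurve Z s t) / 2 ≤
      frechetDist (seg (Z 0) (Z 1)) Z by linarith
  refine le_csInf ⟨_, _, .id, rfl⟩ ?_
  rintro _ ⟨f, hf, rfl⟩
  have hw {x : ℝ} (hx : x ∈ Icc (0 : ℝ) 1) :=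
    norm_sub_le_frechetWidth hf (continuous_seg (Z 0) (Z 1)).continuousOn hZ hx
  obtain ⟨g, hg, hgf⟩ := hf.exists_restrict hs hst ht
  rw [div_le_iff₀' two_pos]
  refine frechetDist_le_of_forall_norm_le hg fun x hx => ?_
  have hσ : s + x * (t - s) ∈ Icc (0 : ℝ) 1 := by
    obtain ⟨h0, h1⟩ := hx
    constructor <;> nlinarith
  have hsub := norm_seg_sub_seg_le (hg.mapsTo hx)
    ((norm_sub_rev _ _).trans_le (hw ⟨hs, hst.trans ht⟩))
    ((norm_sub_rev _ _).trans_le (hw ⟨hs.trans hst, ht⟩))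
  rw [seg_seg, hgf x hx] at hsub
  rw [two_mul]
  exact (norm_sub_le_norm_sub_add_norm_sub _ _ _).trans (add_le_add hsub (hw hσ))

end Jaywalk
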